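/- Let p ∈ ℝ², s > 0, and let C̄₀ ≥ 1 be fixed. Suppose B_r(q) ⊆ B_s(p) with r ≥ s/C̄₀ and dist(B_r(q), ∂B_s(p)) ≥ s/C̄₀. Then there exists a constant C̃₀, depending only on C̄₀ (not on s, q, r, u), such that for every u ∈ H¹(B_s(p)), |avg_{∂B_r(q)} u − avg_{∂B_s(p)} u| ≤ C̃₀ ‖∇u‖_{L²(B_s(p))}, where avg denotes the average over the circle with respect to arclength. -/

import Mathlib

open MeasureTheory Metric Real

/-- The average of `u` on the circle of center `q` and radius `r` in `ℝ²`,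
with respect to arclength. -/
noncomputable def circAvg (u : EuclideanSpace ℝ (Fin 2) → ℝ)
    (q : EuclideanSpace ℝ (Fin 2)) (r : ℝ) : ℝ :=
  (2 * π)⁻¹ * ∫ θ in (0 : ℝ)..(2 * π),
    u (q + EuclideanSpace.single 0 (r * cos θ) + EuclideanSpace.single 1 (r * sin θ))


noncomputable def annMap (a b d e r m : ℝ) (z : ℝ × ℝ) : ℝ × ℝ :=
  (a + z.2 * d + (r + z.2 * m) * cos z.1, b + z.2 * e + (r + z.2 * m) * sin z.1)

noncomputable def annDeriv (d e r m : ℝ) (z : ℝ × ℝ) : ℝ × ℝ →L[ℝ] ℝ × ℝ :=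
  LinearMap.toContinuousLinearMap (Matrix.toLin (Module.Basis.finTwoProd ℝ) (Module.Basis.finTwoProd ℝ)
    !![-(r + z.2 * m) * sin z.1, d + m * cos z.1; (r + z.2 * m) * cos z.1, e + m * sin z.1])

lemma annDeriv_det (d e r m : ℝ) (z : ℝ × ℝ) :
    (annDeriv d e r m z).det = -((r + z.2 * m) * (m + d * cos z.1 + e * sin z.1)) := by
  have h := sin_sq_add_cos_sq z.1
  simp only [annDeriv, LinearMap.det_toContinuousLinearMap, LinearMap.det_toLin,
    Matrix.det_fin_two_of]
  linear_combination (-(r + z.2 * m) * m) * h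

lemma hasFDerivAt_annMap (a b d e r m : ℝ) (z : ℝ × ℝ) :
    HasFDerivAt (annMap a b d e r m) (annDeriv d e r m z) z := by
  unfold annMap annDeriv
  rw [Matrix.toLin_finTwoProd_toContinuousLinearMap]
  have h1 : HasFDerivAt (fun z : ℝ × ℝ => z.1) (ContinuousLinearMap.fst ℝ ℝ ℝ) z := hasFDerivAt_fst
  have h2 : HasFDerivAt (fun z : ℝ × ℝ => z.2) (ContinuousLinearMap.snd ℝ ℝ ℝ) z := hasFDerivAt_snd
  have hr := (h2.mul_const m).const_add r
  convert! HasFDerivAt.prodMk (𝕜 := ℝ)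
    (((h2.mul_const d).const_add a).add (hr.mul h1.cos))
    (((h2.mul_const e).const_add b).add (hr.mul h1.sin)) using 2 <;>
  · ext <;> simp <;> ring

lemma annMap_injOn (a b d e r m : ℝ) (hr : 0 < r) (hm : 0 < m) (hD : d ^ 2 + e ^ 2 < m ^ 2) :
    Set.InjOn (annMap a b d e r m) (Set.Ioo 0 (2 * π) ×ˢ Set.Ioo 0 1) := by
  rintro ⟨θ, t⟩ ⟨⟨h1, h2⟩, h3, h4⟩ ⟨θ', t'⟩ ⟨⟨h1', h2'⟩, h3', h4'⟩ h
  simp only [annMap, Prod.mk.injEq] at h h1 h2 h3 h4 h1' h2' h3' h4'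
  obtain ⟨hx, hy⟩ := h
  have hρ : 0 < r + t * m := by positivity
  have hρ' : 0 < r + t' * m := by positivity
  have hc : cos (θ - θ') ≤ 1 := cos_le_one _
  rw [cos_sub] at hc
  have k := sin_sq_add_cos_sq θ
  have k' := sin_sq_add_cos_sq θ'
  have key : (t - t') ^ 2 * (d ^ 2 + e ^ 2) = (r + t * m) ^ 2 + (r + t' * m) ^ 2
      - 2 * ((r + t * m) * (r + t' * m)) * (cos θ * cos θ' + sin θ * sin θ') := by
    have hx' : (t - t') * d = (r + t' * m) * cos θ' - (r + t * m) * cos θ := by linarith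
    have hy' : (t - t') * e = (r + t' * m) * sin θ' - (r + t * m) * sin θ := by linarith
    calc (t - t') ^ 2 * (d ^ 2 + e ^ 2) = ((t - t') * d) ^ 2 + ((t - t') * e) ^ 2 := by ring
      _ = _ := by
        rw [hx', hy']
        linear_combination (r + t * m) ^ 2 * k + (r + t' * m) ^ 2 * k'
  have key2 : (t - t') ^ 2 * (m ^ 2 - (d ^ 2 + e ^ 2)) ≤ 0 := by
    have := mul_le_mul_of_nonneg_left hc (mul_pos hρ hρ').le
    nlinarith
  have ht : t = t' := by
    by_contra hne
    have : 0 < (t - t') ^ 2 := by have := sub_ne_zero.2 hne; positivity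
    have := mul_pos this (sub_pos.2 hD)
    linarith
  subst ht
  have hcos : cos θ = cos θ' := by
    apply mul_left_cancel₀ hρ.ne'; linarith
  have hsin : sin θ = sin θ' := by
    apply mul_left_cancel₀ hρ.ne'; linarith
  have h1 : cos (θ - θ') = 1 := by rw [cos_sub, hcos, hsin]; linarith
  have := (cos_eq_one_iff_of_lt_of_lt (by linarith) (by linarith)).1 h1
  rw [sub_eq_zero.1 this]

def toE (z : ℝ × ℝ) : EuclideanSpace ℝ (Fin 2) := !₂[z.1, z.2]

lemma toE_mp : MeasurePreserving toE := by
  exact (PiLp.volume_preserving_toLp (Fin 2)).comp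
    (volume_preserving_finTwoArrow ℝ).symm

lemma toE_emb : MeasurableEmbedding toE := by
  exact (MeasurableEquiv.toLp 2 (Fin 2 → ℝ)).measurableEmbedding.comp
    (MeasurableEquiv.finTwoArrow (α := ℝ)).symm.measurableEmbedding

lemma toE_cont : Continuous toE := by
  unfold toE
  fun_prop

/-- Cauchy–Schwarz against the constant 1. -/
lemma cs_one {α : Type*} [MeasurableSpace α] (μ : Measure α) [IsFiniteMeasure μ] (V : ℝ)
    (hV : μ.real Set.univ = V) (hV0 : 0 < V) (M : α → ℝ) (h1 : Integrable M μ)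
    (h2 : Integrable (fun x => M x ^ 2) μ) :
    (∫ x, M x ∂μ) ^ 2 ≤ V * ∫ x, M x ^ 2 ∂μ := by
  set I := ∫ x, M x ∂μ with hI
  have h0 : 0 ≤ ∫ x, (M x - I / V) ^ 2 ∂μ := integral_nonneg fun x => sq_nonneg _
  have : ∫ x, (M x - I / V) ^ 2 ∂μ = ∫ x, M x ^ 2 ∂μ - 2 * (I / V) * I + (I / V) ^ 2 * V := by
    have e1 : (fun x => (M x - I / V) ^ 2) =
        fun x => (M x ^ 2 - 2 * (I / V) * M x) + (I / V) ^ 2 := by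
      funext x; ring
    have hs : Integrable (fun x => M x ^ 2 - 2 * (I / V) * M x) μ := h2.sub (h1.const_mul _)
    rw [e1, integral_add hs (integrable_const _),
      integral_sub h2 (h1.const_mul _), integral_const_mul, integral_const, hV, smul_eq_mul, ← hI]
    ring
  rw [this] at h0
  have h3 : 0 ≤ V * (∫ x, M x ^ 2 ∂μ - 2 * (I / V) * I + (I / V) ^ 2 * V) := by positivity
  have h4 : V * (∫ x, M x ^ 2 ∂μ - 2 * (I / V) * I + (I / V) ^ 2 * V)
    = V * (∫ x, M x ^ 2 ∂μ) - I ^ 2 := by field_simp; ring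
  linarith

/-- Change of variables inequality. -/
lemma cov_le (a b d e r m κ : ℝ) (hr : 0 < r) (hm : 0 < m) (hD : d ^ 2 + e ^ 2 < m ^ 2)
    (f : EuclideanSpace ℝ (Fin 2) → ℝ) (hf : ∀ x, 0 ≤ f x) (B : Set (EuclideanSpace ℝ (Fin 2)))
    (hfB : IntegrableOn f B)
    (hκ : ∀ z ∈ Set.Ioo 0 (2 * π) ×ˢ Set.Ioo (0:ℝ) 1,
      κ ≤ (r + z.2 * m) * (m + d * cos z.1 + e * sin z.1))
    (hB : ∀ z ∈ Set.Ioo 0 (2 * π) ×ˢ Set.Ioo (0:ℝ) 1, toE (annMap a b d e r m z) ∈ B)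
    (hint : IntegrableOn (fun z => f (toE (annMap a b d e r m z)))
      (Set.Ioo 0 (2 * π) ×ˢ Set.Ioo 0 1)) :
    κ * ∫ z in Set.Ioo 0 (2 * π) ×ˢ Set.Ioo 0 1, f (toE (annMap a b d e r m z)) ≤ 
      ∫ x in B, f x := by
  set S : Set (ℝ × ℝ) := Set.Ioo 0 (2 * π) ×ˢ Set.Ioo 0 1 with hS
  have hSm : MeasurableSet S := measurableSet_Ioo.prod measurableSet_Ioo
  have hd : ∀ z ∈ S, HasFDerivWithinAt (annMap a b d e r m) (annDeriv d e r m z) S z :=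
    fun z _ => (hasFDerivAt_annMap a b d e r m z).hasFDerivWithinAt
  have hinj := annMap_injOn a b d e r m hr hm hD
  have hpre : ∫ z in toE ⁻¹' B, f (toE z) = ∫ x in B, f x :=
    toE_mp.setIntegral_preimage_emb toE_emb f B
  have hpreI : IntegrableOn (fun z => f (toE z)) (toE ⁻¹' B) :=
    (toE_mp.integrableOn_comp_preimage toE_emb).2 hfB
  have hsub : annMap a b d e r m '' S ⊆ toE ⁻¹' B := by
    rintro _ ⟨z, hz, rfl⟩; exact hB z hz
  have h1 : ∫ z in annMap a b d e r m '' S, f (toE z) ≤ ∫ z in toE ⁻¹' B, f (toE z) :=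
    setIntegral_mono_set hpreI (Filter.Eventually.of_forall fun z => hf _)
      (Filter.Eventually.of_forall hsub)
  have hI2 := (integrableOn_image_iff_integrableOn_abs_det_fderiv_smul volume hSm hd hinj
    (fun z => f (toE z))).1 (hpreI.mono_set hsub)
  rw [integral_image_eq_integral_abs_det_fderiv_smul volume hSm hd hinj, hpre] at h1
  refine le_trans ?_ h1
  rw [← integral_const_mul]
  refine setIntegral_mono_on (hint.const_mul κ) hI2 hSm fun z hz => ?_
  rw [annDeriv_det, abs_neg, smul_eq_mul]
  exact mul_le_mul_of_nonneg_right ((hκ z hz).trans (le_abs_self _)) (hf _)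

lemma lin_bound (d e D c n : ℝ) (hD : 0 ≤ D) (hde : d ^ 2 + e ^ 2 = D ^ 2) (h : n ^ 2 + c ^ 2 = 1) :
    |d * c + e * n| ≤ D := by
  apply abs_le_of_sq_le_sq _ hD
  have : (d * c + e * n) ^ 2 + (d * n - e * c) ^ 2 = D ^ 2 := by
    calc _ = (d ^ 2 + e ^ 2) * (n ^ 2 + c ^ 2) := by ring
      _ = _ := by rw [h, hde, mul_one]
  nlinarith [sq_nonneg (d * n - e * c)]

lemma norm_toE_le (x y R : ℝ) (hR : 0 ≤ R) (h : x ^ 2 + y ^ 2 ≤ R ^ 2) : ‖toE (x, y)‖ ≤ R := by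
  rw [EuclideanSpace.norm_eq]
  apply Real.sqrt_le_iff.2 ⟨hR, ?_⟩
  simpa [toE, Fin.sum_univ_two] using h

/-- Point on the interpolating circle. -/
noncomputable def annX (p q : EuclideanSpace ℝ (Fin 2)) (s r : ℝ) (z : ℝ × ℝ) :
    EuclideanSpace ℝ (Fin 2) :=
  toE (annMap (q 0) (q 1) (p 0 - q 0) (p 1 - q 1) r (s - r) z)

noncomputable def annV (p q : EuclideanSpace ℝ (Fin 2)) (s r : ℝ) (θ : ℝ) :
    EuclideanSpace ℝ (Fin 2) :=
  toE (p 0 - q 0 + (s - r) * cos θ, p 1 - q 1 + (s - r) * sin θ)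

lemma dist_coord (p q : EuclideanSpace ℝ (Fin 2)) :
    (p 0 - q 0) ^ 2 + (p 1 - q 1) ^ 2 = dist p q ^ 2 := by
  rw [EuclideanSpace.dist_eq, Real.sq_sqrt (by positivity)]
  simp [Fin.sum_univ_two, Real.dist_eq, sq_abs]

lemma norm_annV (p q : EuclideanSpace ℝ (Fin 2)) (s r : ℝ) (θ : ℝ) (hr : 0 < r)
    (h : dist p q + r ≤ s) : ‖annV p q s r θ‖ ≤ 2 * s := by
  have hde := dist_coord p q
  have h0 : 0 ≤ dist p q := dist_nonneg
  apply norm_toE_le _ _ _ (by linarith)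
  have hl := abs_le.1 (lin_bound _ _ _ _ _ h0 hde (sin_sq_add_cos_sq θ))
  have k := sin_sq_add_cos_sq θ
  have : (p 0 - q 0 + (s - r) * cos θ) ^ 2 + (p 1 - q 1 + (s - r) * sin θ) ^ 2
      = dist p q ^ 2 + (s - r) ^ 2 +
        2 * (s - r) * ((p 0 - q 0) * cos θ + (p 1 - q 1) * sin θ) := by
    linear_combination hde + (s - r) ^ 2 * k
  rw [this]
  have h2 := mul_le_mul_of_nonneg_left hl.2 (show 0 ≤ 2 * (s - r) by linarith)
  have h3 : (dist p q + (s - r)) ^ 2 ≤ (2 * s) ^ 2 := by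
    apply pow_le_pow_left₀ <;> linarith
  nlinarith

lemma dist_annX (p q : EuclideanSpace ℝ (Fin 2)) (s r : ℝ) (z : ℝ × ℝ) (hr : 0 < r)
    (h : dist p q + r ≤ s) (hz : z.2 ∈ Set.Icc (0 : ℝ) 1) :
    dist (annX p q s r z) p ≤ (1 - z.2) * dist p q + (r + z.2 * (s - r)) := by
  obtain ⟨θ, t⟩ := z
  simp only at hz ⊢
  have hde := dist_coord p q
  have h0 : 0 ≤ dist p q := dist_nonneg
  have hl := abs_le.1 (lin_bound _ _ _ _ _ h0 hde (sin_sq_add_cos_sq θ))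
  have k := sin_sq_add_cos_sq θ
  have h1 : 0 ≤ 1 - t := by linarith [hz.2]
  have hρ : 0 ≤ r + t * (s - r) := by
    have := mul_nonneg hz.1 (show 0 ≤ s - r by linarith)
    linarith
  have e1 : annX p q s r (θ, t) - p =
      toE ((t - 1) * (p 0 - q 0) + (r + t * (s - r)) * cos θ,
        (t - 1) * (p 1 - q 1) + (r + t * (s - r)) * sin θ) := by
    ext i
    fin_cases i <;> simp [annX, annMap, toE] <;> ring
  rw [dist_eq_norm, e1]
  apply norm_toE_le _ _ _ (by positivity)
  have : ((t - 1) * (p 0 - q 0) + (r + t * (s - r)) * cos θ) ^ 2 +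
      ((t - 1) * (p 1 - q 1) + (r + t * (s - r)) * sin θ) ^ 2
      = (1 - t) ^ 2 * dist p q ^ 2 + (r + t * (s - r)) ^ 2 -
        2 * ((1 - t) * (r + t * (s - r))) * ((p 0 - q 0) * cos θ + (p 1 - q 1) * sin θ) := by
    linear_combination (1 - t) ^ 2 * hde + (r + t * (s - r)) ^ 2 * k
  rw [this]
  have h2 := mul_le_mul_of_nonneg_left hl.1 (show 0 ≤ 2 * ((1 - t) * (r + t * (s - r))) by positivity)
  nlinarith

lemma annX_cont (p q : EuclideanSpace ℝ (Fin 2)) (s r : ℝ) : Continuous (annX p q s r) := by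
  unfold annX annMap
  exact toE_cont.comp (by fun_prop)

lemma annV_cont (p q : EuclideanSpace ℝ (Fin 2)) (s r : ℝ) : Continuous (annV p q s r) := by
  unfold annV
  exact toE_cont.comp (by fun_prop)

lemma annX_deriv (p q : EuclideanSpace ℝ (Fin 2)) (s r θ t : ℝ) :
    HasDerivAt (fun t => annX p q s r (θ, t)) (annV p q s r θ) t := by
  have : (fun t => annX p q s r (θ, t)) = fun t => annX p q s r (θ, 0) + t • annV p q s r θ := by
    funext t
    ext i
    fin_cases i <;> simp [annX, annV, annMap, toE] <;> ring
  rw [this]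
  simpa using ((hasDerivAt_id t).smul_const (annV p q s r θ)).const_add (annX p q s r (θ, 0))

lemma main_bound (C₀ : ℝ) (hC₀ : 1 ≤ C₀) (p q : EuclideanSpace ℝ (Fin 2)) (s r : ℝ)
    (hs : 0 < s) (hr : 0 < r) (hsr : s / C₀ ≤ r) (hd : dist p q + r + s / C₀ ≤ s)
    (u : EuclideanSpace ℝ (Fin 2) → ℝ) (hu : ContDiffOn ℝ 1 u (closedBall p s)) :
    |circAvg u q r - circAvg u p s| ≤
      (2 * C₀) * Real.sqrt (∫ x in ball p s, ‖fderiv ℝ u x‖ ^ 2) := by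
  have hC : 0 < C₀ := by linarith
  have hsC : 0 < s / C₀ := by positivity
  have h0 : 0 ≤ dist p q := dist_nonneg
  have hd' : dist p q + r ≤ s := by linarith
  set K := closedBall p s with hK
  set X := annX p q s r with hX
  set V := annV p q s r with hV
  have hXK : ∀ z : ℝ × ℝ, z.2 ∈ Set.Icc (0 : ℝ) 1 → X z ∈ K := fun z hz => by
    rw [hK, mem_closedBall]
    refine (dist_annX p q s r z hr hd' hz).trans ?_
    nlinarith [hz.1, hz.2, mul_nonneg (sub_nonneg.2 hz.2) (sub_nonneg.2 hd')]
  have hXB : ∀ z : ℝ × ℝ, z.2 ∈ Set.Ioo (0 : ℝ) 1 → X z ∈ ball p s := fun z hz => by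
    rw [mem_ball]
    refine (dist_annX p q s r z hr hd' ⟨hz.1.le, hz.2.le⟩).trans_lt ?_
    have : 0 < (1 - z.2) * (s - (dist p q + r)) := mul_pos (by linarith [hz.2]) (by linarith)
    nlinarith
  have hUD : UniqueDiffOn ℝ K := uniqueDiffOn_convex (convex_closedBall p s)
    ⟨p, ball_subset_interior_closedBall (mem_ball_self hs)⟩
  set g := fderivWithin ℝ u K with hg
  have hgc : ContinuousOn g K := hu.continuousOn_fderivWithin hUD (by norm_num)
  have hgB : ∀ x ∈ ball p s, g x = fderiv ℝ u x := fun x hx =>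
    fderivWithin_of_mem_nhds (Filter.mem_of_superset (isOpen_ball.mem_nhds hx) ball_subset_closedBall)
  set Q : Set (ℝ × ℝ) := Set.Icc 0 (2 * π) ×ˢ Set.Icc 0 1 with hQ
  have hQc : IsCompact Q := isCompact_Icc.prod isCompact_Icc
  have hXc : Continuous X := annX_cont p q s r
  have hgX : ContinuousOn (fun z => g (X z)) Q :=
    hgc.comp hXc.continuousOn fun z hz => hXK z hz.2
  have hF : ContinuousOn (fun z => g (X z) (V z.1)) Q :=
    hgX.clm_apply ((annV_cont p q s r).comp continuous_fst).continuousOn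
  set S : Set (ℝ × ℝ) := Set.Ioo 0 (2 * π) ×ˢ Set.Ioo 0 1 with hS
  have hSm : MeasurableSet S := measurableSet_Ioo.prod measurableSet_Ioo
  have hSQ : S ⊆ Q := Set.prod_mono Set.Ioo_subset_Icc_self Set.Ioo_subset_Icc_self
  have hM : IntegrableOn (fun z => ‖g (X z)‖) S :=
    (hgX.norm.integrableOn_compact hQc).mono_set hSQ
  have hM2 : IntegrableOn (fun z => ‖g (X z)‖ ^ 2) S :=
    ((hgX.norm.pow 2).integrableOn_compact hQc).mono_set hSQ
  have hFI : IntegrableOn (fun z => g (X z) (V z.1)) S :=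
    (hF.integrableOn_compact hQc).mono_set hSQ
  have hpi : 0 < 2 * π := by positivity
  -- FTC
  have hftc : ∀ θ ∈ Set.Ioo 0 (2 * π),
      ∫ t in Set.Ioo (0 : ℝ) 1, g (X (θ, t)) (V θ) = u (X (θ, 1)) - u (X (θ, 0)) := by
    intro θ hθ
    rw [← integral_Ioc_eq_integral_Ioo, ← intervalIntegral.integral_of_le zero_le_one]
    have hpath : ContinuousOn (fun t : ℝ => X (θ, t)) (Set.Icc 0 1) := 
      (hXc.comp (by fun_prop)).continuousOn
    apply intervalIntegral.integral_eq_sub_of_hasDerivAt_of_le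
      (f := fun t => u (X (θ, t))) (f' := fun t => g (X (θ, t)) (V θ)) zero_le_one
    · exact hu.continuousOn.comp hpath fun t ht => hXK (θ, t) ht
    · intro t ht
      have hb := hXB (θ, t) ht
      have hdu : HasFDerivAt u (g (X (θ, t))) (X (θ, t)) := by
        rw [hgB _ hb]
        exact ((hu.differentiableOn (by norm_num)).differentiableAt
          (Filter.mem_of_superset (isOpen_ball.mem_nhds hb) ball_subset_closedBall)).hasFDerivAt
      exact hdu.comp_hasDerivAt t (annX_deriv p q s r θ t)
    · apply ContinuousOn.intervalIntegrable
      rw [Set.uIcc_of_le zero_le_one]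
      exact (hgc.comp hpath fun t ht => hXK (θ, t) ht).clm_apply continuousOn_const
  have hui : ∀ t ∈ Set.Icc (0 : ℝ) 1, IntervalIntegrable (fun θ => u (X (θ, t))) volume 0 (2 * π) := by
    intro t ht
    apply Continuous.intervalIntegrable
    exact hu.continuousOn.comp_continuous (hXc.comp (by fun_prop)) fun θ => hXK (θ, t) ht
  have hA : circAvg u p s - circAvg u q r = (2 * π)⁻¹ * ∫ z in S, g (X z) (V z.1) := by
    have hp : circAvg u p s = (2 * π)⁻¹ * ∫ θ in (0 : ℝ)..(2 * π), u (X (θ, 1)) := by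
      unfold circAvg
      congr 2
      funext θ
      congr 1
      ext i
      fin_cases i <;> simp [hX, annX, annMap, toE]
    have hq : circAvg u q r = (2 * π)⁻¹ * ∫ θ in (0 : ℝ)..(2 * π), u (X (θ, 0)) := by
      unfold circAvg
      congr 2
      funext θ
      congr 1
      ext i
      fin_cases i <;> simp [hX, annX, annMap, toE]
    rw [hp, hq, ← mul_sub, ← intervalIntegral.integral_sub (hui 1 (by simp)) (hui 0 (by simp))]
    congr 1
    rw [intervalIntegral.integral_of_le hpi.le, integral_Ioc_eq_integral_Ioo]
    rw [hS, Measure.volume_eq_prod, setIntegral_prod _ hFI]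
    exact (setIntegral_congr_fun measurableSet_Ioo hftc).symm
  -- bound
  have hB1 : |∫ z in S, g (X z) (V z.1)| ≤ 2 * s * ∫ z in S, ‖g (X z)‖ := by
    rw [← integral_const_mul, ← Real.norm_eq_abs]
    refine norm_integral_le_of_norm_le (hM.const_mul _) (Filter.Eventually.of_forall fun z => ?_)
    refine ((g (X z)).le_opNorm _).trans ?_
    rw [mul_comm]
    exact mul_le_mul_of_nonneg_right (norm_annV p q s r z.1 hr hd') (norm_nonneg _)
  have hvol : (volume : Measure (ℝ × ℝ)) S = ENNReal.ofReal (2 * π) := by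
    rw [hS, Measure.volume_eq_prod, Measure.prod_prod]
    simp
  have : IsFiniteMeasure (volume.restrict S) := ⟨by
    rw [Measure.restrict_apply_univ, hvol]; exact ENNReal.ofReal_lt_top⟩
  have hB2 : (∫ z in S, ‖g (X z)‖) ^ 2 ≤ 2 * π * ∫ z in S, ‖g (X z)‖ ^ 2 :=
    cs_one (volume.restrict S) (2 * π) (by simp [Measure.real, hvol, pi_pos.le]) hpi _ hM hM2
  have hgI : IntegrableOn (fun x => ‖g x‖ ^ 2) (ball p s) :=
    ((hgc.norm.pow 2).integrableOn_compact (isCompact_closedBall p s)).mono_set ball_subset_closedBall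
  have hde := dist_coord p q
  have hB3 : (s / C₀) ^ 2 * ∫ z in S, ‖g (X z)‖ ^ 2 ≤ ∫ x in ball p s, ‖g x‖ ^ 2 := by
    refine cov_le _ _ _ _ r (s - r) _ hr (by linarith) ?_ (fun x => ‖g x‖ ^ 2)
      (fun x => by positivity) _ hgI ?_ (fun z hz => hXB z hz.2) hM2
    · rw [hde]
      exact pow_lt_pow_left₀ (by linarith) h0 (by norm_num)
    · intro z hz
      have hl := abs_le.1 (lin_bound _ _ _ _ _ h0 hde (sin_sq_add_cos_sq z.1))
      have h1 := mul_nonneg hz.2.1.le (show 0 ≤ s - r by linarith)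
      rw [sq]
      apply mul_le_mul <;> linarith
  have hB4 : ∫ x in ball p s, ‖g x‖ ^ 2 = ∫ x in ball p s, ‖fderiv ℝ u x‖ ^ 2 :=
    setIntegral_congr_fun measurableSet_ball fun x hx => by simp only [hgB x hx]
  rw [hB4] at hB3
  set J := ∫ x in ball p s, ‖fderiv ℝ u x‖ ^ 2
  set I2 := ∫ z in S, ‖g (X z)‖ ^ 2
  set I1 := ∫ z in S, ‖g (X z)‖
  have hJ : 0 ≤ J := integral_nonneg fun x => by positivity
  have hI1 : 0 ≤ I1 := integral_nonneg fun x => norm_nonneg _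
  rw [abs_sub_comm, hA, abs_mul, abs_of_pos (inv_pos.2 hpi)]
  have hI1' : s * I1 ≤ 2 * π * C₀ * √J := by
    apply le_of_sq_le_sq _ (by positivity)
    rw [mul_pow (2 * π * C₀), Real.sq_sqrt hJ]
    have e1 : s ^ 2 * I2 ≤ C₀ ^ 2 * J := by
      rw [div_pow, div_mul_eq_mul_div, div_le_iff₀ (by positivity)] at hB3
      linarith
    have e2 : (s * I1) ^ 2 ≤ 2 * π * (C₀ ^ 2 * J) := by
      calc (s * I1) ^ 2 = s ^ 2 * I1 ^ 2 := by ring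
        _ ≤ s ^ 2 * (2 * π * I2) := by gcongr
        _ = 2 * π * (s ^ 2 * I2) := by ring
        _ ≤ _ := by gcongr
    have e3 : 1 ≤ 2 * π := by linarith [pi_gt_three]
    have e4 : 0 ≤ 2 * π * (C₀ ^ 2 * J) := by positivity
    nlinarith
  calc (2 * π)⁻¹ * _ ≤ (2 * π)⁻¹ * (2 * s * I1) := by gcongr
    _ = (2 * π)⁻¹ * 2 * (s * I1) := by ring
    _ ≤ (2 * π)⁻¹ * 2 * (2 * π * C₀ * √J) := by gcongr
    _ = _ := by field_simp

/-- Lemma 2.2 of Bartolucci–Malchiodi: if `B_r(q) ⊆ B_s(p)` with `r ≥ s/C̄₀` and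
`dist(B_r(q), ∂B_s(p)) ≥ s/C̄₀`, then the averages of `u` on the circles
`∂B_r(q)` and `∂B_s(p)` differ by at most `C̃₀ ‖∇u‖_{L²(B_s(p))}`, with `C̃₀`
depending only on `C̄₀`. -/
theorem stmt_11 (C₀ : ℝ) (hC₀ : 1 ≤ C₀) :
    ∃ C₁ > (0 : ℝ), ∀ (p q : EuclideanSpace ℝ (Fin 2)) (s r : ℝ),
      0 < s → 0 < r → s / C₀ ≤ r → dist p q + r + s / C₀ ≤ s →
      ∀ u : EuclideanSpace ℝ (Fin 2) → ℝ, ContDiffOn ℝ 1 u (closedBall p s) →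
        |circAvg u q r - circAvg u p s| ≤
          C₁ * Real.sqrt (∫ x in ball p s, ‖fderiv ℝ u x‖ ^ 2) := by
  exact ⟨2 * C₀, by linarith, fun p q s r hs hr hsr hd u hu =>
    main_bound C₀ hC₀ p q s r hs hr hsr hd u hu⟩
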